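/- arXiv:1908.07345 — 3 statements merged into one kernel-verified Lean document; each statement's English description precedes it below -/
import Mathlib

section
/- Let f be a multiplicative arithmetic function and let n and m be positive integers with gcd(n, m) = 1. Then (f * δ)(nm) = (Id * f)(n) · (f * δ)(m) + (Id * f)(m) · (f * δ)(n), where * denotes Dirichlet convolution. -/
open ArithmeticFunction

/-- The arithmetic derivative: `δ(n) = ∑_{p | n} ν_p(n) · (n / p)`,
equivalently `δ(n) = n · ∑_{p^α ∥ n} α / p`, with `δ(0) = 0`. -/
def arithDeriv : ArithmeticFunction ℕ :=
  ⟨fun n => ∑ p ∈ n.primeFactors, n.factorization p * (n / p), by simp⟩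

theorem arithDeriv_apply (n : ℕ) :
    arithDeriv n = ∑ p ∈ n.primeFactors, n.factorization p * (n / p) := rfl

theorem arithDeriv_mul_of_coprime {a b : ℕ} (hab : a.Coprime b) :
    arithDeriv (a * b) = arithDeriv a * b + a * arithDeriv b := by
  simp only [arithDeriv_apply]
  rw [hab.primeFactors_mul, Finset.sum_union hab.disjoint_primeFactors, Finset.sum_mul,
    Finset.mul_sum]
  congr 1
  · refine Finset.sum_congr rfl fun p hp => ?_
    rw [Nat.factorization_eq_of_coprime_left hab (by simpa using hp),
      Nat.mul_div_right_comm (Nat.dvd_of_mem_primeFactors hp), mul_assoc]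
  · refine Finset.sum_congr rfl fun p hp => ?_
    rw [Nat.factorization_eq_of_coprime_right hab (by simpa using hp),
      Nat.mul_div_assoc _ (Nat.dvd_of_mem_primeFactors hp), mul_left_comm]

theorem Nat.Coprime.sum_divisors_mul_eq_sum_sum {M : Type*} [AddCommMonoid M] {n m : ℕ}
    (hnm : n.Coprime m) (F : ℕ → M) :
    ∑ d ∈ (n * m).divisors, F d = ∑ a ∈ n.divisors, ∑ b ∈ m.divisors, F (a * b) := by
  rw [Nat.divisors_mul, Finset.mul_def, Finset.sum_image hnm.mul_injOn_divisors,
    Finset.sum_product]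

/-- For a multiplicative arithmetic function `f` and coprime positive integers `n`, `m`:
`(f * δ)(nm) = (Id * f)(n) · (f * δ)(m) + (Id * f)(m) · (f * δ)(n)`. -/
theorem dirichlet_conv_arithDeriv_mul (f : ArithmeticFunction ℝ)
    (hf : f.IsMultiplicative) (n m : ℕ) (hn : 0 < n) (hm : 0 < m)
    (hnm : Nat.Coprime n m) :
    (f * (↑arithDeriv : ArithmeticFunction ℝ)) (n * m) =
      ((↑(ArithmeticFunction.id) : ArithmeticFunction ℝ) * f) n *
        (f * (↑arithDeriv : ArithmeticFunction ℝ)) m +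
      ((↑(ArithmeticFunction.id) : ArithmeticFunction ℝ) * f) m *
        (f * (↑arithDeriv : ArithmeticFunction ℝ)) n := by
  have key : ∀ a ∈ n.divisors, ∀ b ∈ m.divisors,
      f (a * b) * (arithDeriv (n * m / (a * b)) : ℝ) =
        f a * ((n / a : ℕ) : ℝ) * (f b * (arithDeriv (m / b) : ℝ)) +
          f b * ((m / b : ℕ) : ℝ) * (f a * (arithDeriv (n / a) : ℝ)) := by
    intro a ha b hb
    have ha := Nat.dvd_of_mem_divisors ha
    have hb := Nat.dvd_of_mem_divisors hb
    rw [hf.map_mul_of_coprime (hnm.of_dvd ha hb), Nat.mul_div_mul_comm ha hb,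
      arithDeriv_mul_of_coprime (hnm.of_dvd (Nat.div_dvd_of_dvd ha) (Nat.div_dvd_of_dvd hb))]
    push_cast
    ring
  rw [mul_comm (ArithmeticFunction.natToArithmeticFunction ArithmeticFunction.id) f]
  simp only [mul_apply, natCoe_apply, id_apply]
  rw [Nat.sum_divisorsAntidiagonal fun x y => f x * (arithDeriv y : ℝ),
    Nat.sum_divisorsAntidiagonal fun x y => f x * (arithDeriv y : ℝ),
    Nat.sum_divisorsAntidiagonal fun x y => f x * (arithDeriv y : ℝ),
    Nat.sum_divisorsAntidiagonal fun x y => f x * (y : ℝ),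
    Nat.sum_divisorsAntidiagonal fun x y => f x * (y : ℝ),
    hnm.sum_divisors_mul_eq_sum_sum,
    Finset.sum_congr rfl fun a ha => Finset.sum_congr rfl (key a ha)]
  simp only [Finset.sum_add_distrib]
  rw [Finset.sum_mul_sum, Finset.sum_mul_sum]
  exact congrArg _ Finset.sum_comm
end

section
/- Let f be a multiplicative arithmetic function and let n be a positive integer with prime factorization n = p₁^{α₁} ⋯ p_s^{α_s}, and suppose (Id * f)(p_i^{α_i}) ≠ 0 for each i. Then (f * δ)(n) = (Id * f)(n) · ∑_{i=1}^{s} (f * δ)(p_i^{α_i}) / (Id * f)(p_i^{α_i}). -/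
open ArithmeticFunction

lemma arithDeriv_one : arithDeriv 1 = 0 := by
  change ∑ p ∈ (1 : ℕ).primeFactors, (1 : ℕ).factorization p * (1 / p) = 0
  simp

lemma arithDeriv_mul_of_coprime_s1 {m n : ℕ} (hmn : m.Coprime n) :
    arithDeriv (m * n) = arithDeriv m * n + m * arithDeriv n := by
  change ∑ p ∈ (m * n).primeFactors, (m * n).factorization p * (m * n / p) =
    (∑ p ∈ m.primeFactors, m.factorization p * (m / p)) * n +
      m * ∑ p ∈ n.primeFactors, n.factorization p * (n / p)
  rw [hmn.primeFactors_mul, Finset.sum_union hmn.disjoint_primeFactors, Finset.sum_mul,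
    Finset.mul_sum]
  congr 1 <;> refine Finset.sum_congr rfl fun p hp => ?_
  · rw [Nat.factorization_eq_of_coprime_left hmn
      (Nat.mem_primeFactors_iff_mem_primeFactorsList.1 hp),
      Nat.mul_div_right_comm (Nat.dvd_of_mem_primeFactors hp), mul_assoc]
  · rw [Nat.factorization_eq_of_coprime_right hmn
      (Nat.mem_primeFactors_iff_mem_primeFactorsList.1 hp),
      Nat.mul_div_assoc _ (Nat.dvd_of_mem_primeFactors hp), mul_left_comm]

namespace ArithmeticFunction

/-- The arithmetic function `n ↦ g n + d n ε` with values in the dual numbers. -/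
def toDualNumber {R : Type*} [CommSemiring R] (g d : ArithmeticFunction R) :
    ArithmeticFunction (DualNumber R) :=
  ⟨fun n => (g n, d n), by simp only [map_zero]; rfl⟩

@[simp]
lemma fst_toDualNumber {R : Type*} [CommSemiring R] (g d : ArithmeticFunction R) (n : ℕ) :
    (toDualNumber g d n).fst = g n := rfl

@[simp]
lemma snd_toDualNumber {R : Type*} [CommSemiring R] (g d : ArithmeticFunction R) (n : ℕ) :
    (toDualNumber g d n).snd = d n := rfl

lemma toDualNumber_mul {R : Type*} [CommSemiring R] (f g d : ArithmeticFunction R) :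
    toDualNumber f 0 * toDualNumber g d = toDualNumber (f * g) (f * d) := by
  ext n <;> simp [mul_apply, TrivSqZeroExt.fst_sum, TrivSqZeroExt.snd_sum]

/-- A function into the dual numbers is multiplicative exactly when its first component is
multiplicative and its second one satisfies the Leibniz rule on coprime arguments. -/
lemma isMultiplicative_toDualNumber_iff {R : Type*} [CommSemiring R]
    {g d : ArithmeticFunction R} :
    (toDualNumber g d).IsMultiplicative ↔ g.IsMultiplicative ∧ d 1 = 0 ∧
      ∀ {m n : ℕ}, m.Coprime n → d (m * n) = d m * g n + g m * d n := by
  simp only [IsMultiplicative, TrivSqZeroExt.ext_iff, fst_toDualNumber, snd_toDualNumber,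
    TrivSqZeroExt.fst_one, TrivSqZeroExt.snd_one, TrivSqZeroExt.fst_mul, TrivSqZeroExt.snd_mul,
    smul_eq_mul, MulOpposite.smul_eq_mul_unop, MulOpposite.unop_op]
  constructor
  · rintro ⟨⟨h1, h2⟩, h3⟩
    exact ⟨⟨h1, fun h => (h3 h).1⟩, h2, fun h => by rw [(h3 h).2, add_comm]⟩
  · rintro ⟨⟨h1, h3⟩, h2, h4⟩
    exact ⟨⟨h1, h2⟩, fun h => ⟨h3 h, by rw [h4 h, add_comm]⟩⟩

/-- If `d` satisfies the Leibniz rule relative to the multiplicative function `g` on coprime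
arguments, then the logarithmic derivative `d / g` is additive over prime power factors. -/
lemma eq_mul_sum_div_of_leibniz {K : Type*} [Field K] {g d : ArithmeticFunction K}
    (hg : g.IsMultiplicative) (hd1 : d 1 = 0)
    (hd : ∀ {m n : ℕ}, m.Coprime n → d (m * n) = d m * g n + g m * d n) (n : ℕ)
    (h : ∀ p ∈ n.primeFactors, g (p ^ n.factorization p) ≠ 0) :
    d n = g n * ∑ p ∈ n.primeFactors,
      d (p ^ n.factorization p) / g (p ^ n.factorization p) := by
  induction n using Nat.recOnPosPrimePosCoprime with
  | zero => simp
  | one => simp [hd1]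
  | prime_pow p k hp hk =>
    have hfac : (p ^ k).factorization p = k := by simp [hp.factorization_self]
    rw [Nat.primeFactors_prime_pow hk.ne' hp] at h ⊢
    have hne := h p (Finset.mem_singleton_self p)
    rw [hfac] at hne
    rw [Finset.sum_singleton, hfac, mul_div_cancel₀ _ hne]
  | coprime a b _ _ hab iha ihb =>
    have ha : ∀ p ∈ a.primeFactors, (a * b).factorization p = a.factorization p := fun p hp =>
      Nat.factorization_eq_of_coprime_left hab (Nat.mem_primeFactors_iff_mem_primeFactorsList.1 hp)
    have hb : ∀ p ∈ b.primeFactors, (a * b).factorization p = b.factorization p := fun p hp =>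
      Nat.factorization_eq_of_coprime_right hab (Nat.mem_primeFactors_iff_mem_primeFactorsList.1 hp)
    rw [hab.primeFactors_mul] at h ⊢
    rw [Finset.sum_union hab.disjoint_primeFactors, hd hab, hg.map_mul_of_coprime hab,
      iha fun p hp => ha p hp ▸ h p (Finset.mem_union_left _ hp),
      ihb fun p hp => hb p hp ▸ h p (Finset.mem_union_right _ hp),
      Finset.sum_congr (rfl : a.primeFactors = _) fun p hp =>
        congrArg (fun k => d (p ^ k) / g (p ^ k)) (ha p hp),
      Finset.sum_congr (rfl : b.primeFactors = _) fun p hp =>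
        congrArg (fun k => d (p ^ k) / g (p ^ k)) (hb p hp)]
    ring

end ArithmeticFunction

/-- For a multiplicative arithmetic function `f` and `n = p₁^{α₁} ⋯ p_s^{α_s}` with
`(Id * f)(p_i^{α_i}) ≠ 0` for each `i`:
`(f * δ)(n) = (Id * f)(n) · ∑_i (f * δ)(p_i^{α_i}) / (Id * f)(p_i^{α_i})`. -/
theorem dirichlet_conv_arithDeriv_eq_sum (f : ArithmeticFunction ℝ)
    (hf : f.IsMultiplicative) (n : ℕ) (hn : 0 < n)
    (h : ∀ p ∈ n.primeFactors,
      ((↑(ArithmeticFunction.id) : ArithmeticFunction ℝ) * f) (p ^ n.factorization p) ≠ 0) :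
    (f * (↑arithDeriv : ArithmeticFunction ℝ)) n =
      ((↑(ArithmeticFunction.id) : ArithmeticFunction ℝ) * f) n *
        ∑ p ∈ n.primeFactors,
          (f * (↑arithDeriv : ArithmeticFunction ℝ)) (p ^ n.factorization p) /
            ((↑(ArithmeticFunction.id) : ArithmeticFunction ℝ) * f) (p ^ n.factorization p) := by
  have hδ : (toDualNumber (↑(ArithmeticFunction.id)) (↑arithDeriv) :
      ArithmeticFunction (DualNumber ℝ)).IsMultiplicative :=
    isMultiplicative_toDualNumber_iff.2 ⟨isMultiplicative_id.natCast, by simp [arithDeriv_one],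
      fun hmn => by simp [arithDeriv_mul_of_coprime_s1 hmn]⟩
  have hf' : (toDualNumber f 0).IsMultiplicative :=
    isMultiplicative_toDualNumber_iff.2 ⟨hf, by simp, by simp⟩
  have hprod := hf'.mul hδ
  rw [toDualNumber_mul, isMultiplicative_toDualNumber_iff,
    mul_comm f ↑ArithmeticFunction.id] at hprod
  exact eq_mul_sum_div_of_leibniz hprod.1 hprod.2.1 hprod.2.2 n h
end

section
/- For every positive integer n, 2 · (Id * δ)(n) = τ(n) · δ(n), where τ(n) is the number of positive divisors of n; equivalently (Id * δ)(n) = (1/2) τ(n) δ(n). -/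
open ArithmeticFunction

theorem factorization_mul_div_mul_right (p a b : ℕ) :
    a.factorization p * (a * b / p) = a.factorization p * (a / p) * b := by
  by_cases h : p ∣ a
  · rw [Nat.mul_div_right_comm h, mul_assoc]
  · simp [Nat.factorization_eq_zero_of_not_dvd h]

theorem arithDeriv_eq_sum_of_subset {n : ℕ} {s : Finset ℕ} (h : n.primeFactors ⊆ s) :
    arithDeriv n = ∑ p ∈ s, n.factorization p * (n / p) := by
  refine Finset.sum_subset h fun p _ hp => ?_
  rw [← Nat.support_factorization, Finsupp.notMem_support_iff] at hp
  rw [hp, zero_mul]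

/-- The Leibniz rule for the arithmetic derivative. -/
theorem arithDeriv_mul {a b : ℕ} (ha : a ≠ 0) (hb : b ≠ 0) :
    arithDeriv (a * b) = arithDeriv a * b + a * arithDeriv b := by
  have hab := Nat.primeFactors_mul ha hb
  rw [arithDeriv_eq_sum_of_subset hab.le,
    arithDeriv_eq_sum_of_subset (n := a) (s := a.primeFactors ∪ b.primeFactors)
      Finset.subset_union_left,
    arithDeriv_eq_sum_of_subset (n := b) (s := a.primeFactors ∪ b.primeFactors)
      Finset.subset_union_right,
    Finset.sum_mul, Finset.mul_sum, ← Finset.sum_add_distrib]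
  refine Finset.sum_congr rfl fun p _ => ?_
  rw [Nat.factorization_mul ha hb, Finsupp.add_apply, add_mul,
    factorization_mul_div_mul_right, mul_comm a b, factorization_mul_div_mul_right, mul_comm a]

/-- For every positive integer `n`, `2 · (Id * δ)(n) = τ(n) · δ(n)`,
where `τ = σ₀` is the number-of-divisors function. -/
theorem two_mul_id_conv_arithDeriv (n : ℕ) (hn : 0 < n) :
    2 * ((ArithmeticFunction.id * arithDeriv) n) = (sigma 0) n * arithDeriv n := by
  have hswap : (ArithmeticFunction.id * arithDeriv) n =
      ∑ x ∈ n.divisorsAntidiagonal, arithDeriv x.1 * x.2 := by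
    rw [mul_comm, mul_apply]
    simp only [id_apply]
  have hsum : ∀ x ∈ n.divisorsAntidiagonal,
      x.1 * arithDeriv x.2 + arithDeriv x.1 * x.2 = arithDeriv n := by
    intro x hx
    obtain ⟨hx, -⟩ := Nat.mem_divisorsAntidiagonal.mp hx
    have h0 : x.1 * x.2 ≠ 0 := by rw [hx]; exact hn.ne'
    rw [← hx, arithDeriv_mul (left_ne_zero_of_mul h0) (right_ne_zero_of_mul h0), add_comm]
  rw [two_mul]
  nth_rewrite 2 [hswap]
  rw [mul_apply]
  simp only [id_apply]
  rw [← Finset.sum_add_distrib, Finset.sum_congr rfl hsum, Finset.sum_const, smul_eq_mul,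
    sigma_zero_apply, ← Nat.map_div_right_divisors, Finset.card_map]
end
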